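/- Fix σ > 0 and ũ > 0, and define for 0 < k < 4σ: G(k) = (1/(2k(1+ũ))) ∫₀^k √(q(4σ−q))/(2πσ²) dq + ∫_k^{4σ} [√(q(4σ−q))/(2πσ²)] / (q + 2ũk) dq. Then (G(k) − 1/σ)/√k tends, as k → 0⁺, to σ^{−3/2} ( 1/(3π(1+ũ)) + F₊(ũ) ), where F₊(ũ) = −(√2 √ũ (π − 2 arctan(1/(√2 √ũ))) + 2)/π. -/

import Mathlib

open Real Filter Set intervalIntegral

theorem sqrt_mul_sub_le_two_mul_sqrt {σ q : ℝ} (hσ : 0 < σ) (hq : 0 ≤ q) :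
    √(q * (4 * σ - q)) ≤ 2 * √σ * √q := by
  apply Real.sqrt_le_iff.mpr
  refine ⟨by positivity, ?_⟩
  rw [mul_pow, mul_pow, Real.sq_sqrt hσ.le, Real.sq_sqrt hq]
  nlinarith [sq_nonneg q]

theorem two_mul_sqrt_sub_le_sqrt_mul_sub {σ q : ℝ} (hσ : 0 < σ) (hq : 0 ≤ q)
    (hq' : q ≤ 4 * σ) :
    2 * √σ * √q - q * √q / (2 * √σ) ≤ √(q * (4 * σ - q)) := by
  have hs : 0 < √σ := Real.sqrt_pos.mpr hσ
  have hs2 : √σ ^ 2 = σ := Real.sq_sqrt hσ.le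
  have hfac : 2 * √σ * √q - q * √q / (2 * √σ) = √q * ((4 * σ - q) / (2 * √σ)) := by
    field_simp
    rw [hs2]
    ring
  rw [hfac]
  apply Real.le_sqrt_of_sq_le
  rw [mul_pow, div_pow, mul_pow, Real.sq_sqrt hq, hs2]
  apply mul_le_mul_of_nonneg_left _ hq
  rw [div_le_iff₀ (by positivity)]
  nlinarith [mul_nonneg (sub_nonneg.mpr hq') hq]

theorem integral_sqrt_zero {b : ℝ} (hb : 0 ≤ b) :
    ∫ q in (0 : ℝ)..b, √q = 2 / 3 * (b * √b) := by
  have h : ∀ x ∈ Ioo 0 b, HasDerivAt (fun q : ℝ => 2 / 3 * (q * √q)) (√x) x := by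
    intro x hx
    have hx0 : 0 < x := hx.1
    have hsx : 0 < √x := Real.sqrt_pos.mpr hx0
    have := (((hasDerivAt_id x).mul (Real.hasDerivAt_sqrt hx0.ne')).const_mul (2 / 3 : ℝ))
    refine this.congr_deriv ?_
    have h2 : √x ^ 2 = x := Real.sq_sqrt hx0.le
    simp only [id]
    field_simp
    rw [h2]
    ring
  rw [integral_eq_sub_of_hasDerivAt_of_le hb (by fun_prop) h
    (Real.continuous_sqrt.intervalIntegrable _ _)]
  simp

theorem hasDerivAt_two_mul_sqrt {x : ℝ} (hx : 0 < x) :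
    HasDerivAt (fun q : ℝ => 2 * √q) (√x / x) x := by
  refine ((Real.hasDerivAt_sqrt hx.ne').const_mul 2).congr_deriv ?_
  have hsx : 0 < √x := Real.sqrt_pos.mpr hx
  have h2 : √x ^ 2 = x := Real.sq_sqrt hx.le
  field_simp
  linarith

theorem intervalIntegrable_sqrt_div_self {a b : ℝ} (ha : 0 ≤ a) (hab : a ≤ b) :
    IntervalIntegrable (fun q : ℝ => √q / q) MeasureTheory.volume a b := by
  apply intervalIntegrable_deriv_of_nonneg (g := fun q : ℝ => 2 * √q) (by fun_prop)
  · intro x hx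
    rw [min_eq_left hab] at hx
    exact hasDerivAt_two_mul_sqrt (ha.trans_lt hx.1)
  · intro x hx
    rw [min_eq_left hab] at hx
    have := ha.trans_lt hx.1
    positivity

theorem integral_sqrt_div_self {a b : ℝ} (ha : 0 ≤ a) (hab : a ≤ b) :
    ∫ q in a..b, √q / q = 2 * √b - 2 * √a :=
  integral_eq_sub_of_hasDerivAt_of_le hab (by fun_prop)
    (fun _ hx => hasDerivAt_two_mul_sqrt (ha.trans_lt hx.1))
    (intervalIntegrable_sqrt_div_self ha hab)

theorem hasDerivAt_semicircle_primitive {σ x : ℝ} (hx : x ∈ Ioo 0 (4 * σ)) :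
    HasDerivAt (fun q : ℝ => √(q * (4 * σ - q)) + 2 * σ * arcsin ((q - 2 * σ) / (2 * σ)))
      (√(x * (4 * σ - x)) / x) x := by
  obtain ⟨h0, h1⟩ := hx
  have hσ : 0 < σ := by linarith
  have hp : 0 < x * (4 * σ - x) := mul_pos h0 (by linarith)
  have hW : 0 < √(x * (4 * σ - x)) := Real.sqrt_pos.mpr hp
  have hW2 : √(x * (4 * σ - x)) ^ 2 = x * (4 * σ - x) := Real.sq_sqrt hp.le
  have d1 : HasDerivAt (fun q : ℝ => q * (4 * σ - q)) (1 * (4 * σ - x) + x * (-1)) x :=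
    (hasDerivAt_id x).mul ((hasDerivAt_id x).const_sub (4 * σ))
  have d2 : HasDerivAt (fun q : ℝ => (q - 2 * σ) / (2 * σ)) (1 / (2 * σ)) x :=
    ((hasDerivAt_id x).sub_const (2 * σ)).div_const (2 * σ)
  have hne1 : (x - 2 * σ) / (2 * σ) ≠ -1 := by
    rw [Ne, div_eq_iff (by positivity)]
    intro h
    linarith
  have hne2 : (x - 2 * σ) / (2 * σ) ≠ 1 := by
    rw [Ne, div_eq_iff (by positivity)]
    intro h
    linarith
  have hroot : √(1 - ((x - 2 * σ) / (2 * σ)) ^ 2) = √(x * (4 * σ - x)) / (2 * σ) := by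
    rw [← Real.sqrt_sq (show 0 ≤ 2 * σ by positivity), ← Real.sqrt_div hp.le,
      Real.sqrt_sq (show 0 ≤ 2 * σ by positivity)]
    congr 1
    field_simp
    ring
  have d3 := (d1.sqrt hp.ne').add
    (((Real.hasDerivAt_arcsin hne1 hne2).comp x d2).const_mul (2 * σ))
  refine d3.congr_deriv ?_
  rw [hroot]
  field_simp
  rw [hW2]
  ring

theorem intervalIntegrable_semicircle_div_self {σ : ℝ} (hσ : 0 < σ) :
    IntervalIntegrable (fun q : ℝ => √(q * (4 * σ - q)) / q) MeasureTheory.volume 0 (4 * σ) := by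
  have h : (0 : ℝ) ≤ 4 * σ := by positivity
  apply intervalIntegrable_deriv_of_nonneg
    (g := fun q : ℝ => √(q * (4 * σ - q)) + 2 * σ * arcsin ((q - 2 * σ) / (2 * σ)))
  · exact (by fun_prop : Continuous _).continuousOn
  · intro x hx
    rw [min_eq_left h, max_eq_right h] at hx
    exact hasDerivAt_semicircle_primitive hx
  · intro x hx
    rw [min_eq_left h] at hx
    have := hx.1
    positivity

theorem integral_semicircle_div_self {σ : ℝ} (hσ : 0 < σ) :
    ∫ q in (0 : ℝ)..(4 * σ), √(q * (4 * σ - q)) / q = 2 * π * σ := by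
  rw [integral_eq_sub_of_hasDerivAt_of_le (by positivity)
    (by fun_prop : Continuous _).continuousOn (fun _ hx => hasDerivAt_semicircle_primitive hx)
    (intervalIntegrable_semicircle_div_self hσ)]
  have h1 : (4 * σ - 2 * σ) / (2 * σ) = 1 := by
    field_simp
    ring
  have h2 : (0 - 2 * σ) / (2 * σ) = -1 := by
    field_simp
    ring
  simp only [h1, h2, Real.arcsin_one, Real.arcsin_neg_one]
  simp
  ring

theorem integral_sqrt_mul_div_mul_add {a k b : ℝ} (ha : 0 < a) (hk : 0 < k) (hkb : k ≤ b) :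
    ∫ q in k..b, √q * a ^ 2 / (q * (q + a ^ 2)) =
      2 * a * (arctan (√b / a) - arctan (√k / a)) := by
  have hd : ∀ x ∈ uIcc k b,
      HasDerivAt (fun q : ℝ => 2 * a * arctan (√q / a)) (√x * a ^ 2 / (x * (x + a ^ 2))) x := by
    intro x hx
    rw [uIcc_of_le hkb] at hx
    have hx0 : 0 < x := hk.trans_le hx.1
    have hsx : 0 < √x := Real.sqrt_pos.mpr hx0
    have h2 : √x ^ 2 = x := Real.sq_sqrt hx0.le
    refine ((((Real.hasDerivAt_sqrt hx0.ne').div_const a).arctan).const_mul (2 * a)).congr_deriv ?_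
    rw [div_pow, h2]
    field_simp
    rw [h2]
    ring
  rw [integral_eq_sub_of_hasDerivAt hd]
  · ring
  · apply ContinuousOn.intervalIntegrable
    rw [uIcc_of_le hkb]
    apply ContinuousOn.div (by fun_prop) (by fun_prop)
    intro x hx
    have := hk.trans_le hx.1
    positivity

theorem tendsto_integral_semicircle_div {σ : ℝ} (hσ : 0 < σ) :
    Tendsto (fun k : ℝ => (∫ q in (0 : ℝ)..k, √(q * (4 * σ - q))) / (k * √k))
      (nhdsWithin 0 (Ioi 0)) (nhds (4 / 3 * √σ)) := by
  have hs : 0 < √σ := Real.sqrt_pos.mpr hσ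
  have hlow : Tendsto (fun k : ℝ => 4 / 3 * √σ - k / (2 * √σ) * (2 / 3)) (nhdsWithin 0 (Ioi 0))
      (nhds (4 / 3 * √σ)) := by
    have : Continuous (fun k : ℝ => 4 / 3 * √σ - k / (2 * √σ) * (2 / 3)) := by fun_prop
    simpa using (this.tendsto 0).mono_left nhdsWithin_le_nhds
  have hev : ∀ᶠ k : ℝ in nhdsWithin 0 (Ioi 0), k ∈ Ioo 0 (4 * σ) :=
    Ioo_mem_nhdsGT (by positivity)
  refine tendsto_of_tendsto_of_tendsto_of_le_of_le' hlow tendsto_const_nhds ?_ ?_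
  · filter_upwards [hev] with k ⟨hk, hk'⟩
    have hsk : 0 < √k := Real.sqrt_pos.mpr hk
    rw [le_div_iff₀ (by positivity)]
    have hle : ∫ q in (0 : ℝ)..k, (2 * √σ - k / (2 * √σ)) * √q ≤
        ∫ q in (0 : ℝ)..k, √(q * (4 * σ - q)) := by
      apply integral_mono_on hk.le ((by fun_prop : Continuous _).intervalIntegrable _ _)
        ((by fun_prop : Continuous _).intervalIntegrable _ _)
      intro q hq
      refine le_trans ?_ (two_mul_sqrt_sub_le_sqrt_mul_sub hσ hq.1 (hq.2.trans hk'.le))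
      have : q * √q / (2 * √σ) ≤ k * √q / (2 * √σ) := by
        gcongr
        exact hq.2
      have e : k / (2 * √σ) * √q = k * √q / (2 * √σ) := by ring
      rw [sub_mul, e]
      linarith
    rw [integral_const_mul, integral_sqrt_zero hk.le] at hle
    linarith
  · filter_upwards [hev] with k ⟨hk, hk'⟩
    have hsk : 0 < √k := Real.sqrt_pos.mpr hk
    rw [div_le_iff₀ (by positivity)]
    have hle : ∫ q in (0 : ℝ)..k, √(q * (4 * σ - q)) ≤ ∫ q in (0 : ℝ)..k, (2 * √σ) * √q := by
      apply integral_mono_on hk.le ((by fun_prop : Continuous _).intervalIntegrable _ _)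
        ((by fun_prop : Continuous _).intervalIntegrable _ _)
      intro q hq
      exact sqrt_mul_sub_le_two_mul_sqrt hσ hq.1
    rw [integral_const_mul, integral_sqrt_zero hk.le] at hle
    linarith

theorem tendsto_integral_semicircle_div_self {σ : ℝ} (hσ : 0 < σ) :
    Tendsto (fun k : ℝ => (∫ q in (0 : ℝ)..k, √(q * (4 * σ - q)) / q) / √k)
      (nhdsWithin 0 (Ioi 0)) (nhds (4 * √σ)) := by
  have hs : 0 < √σ := Real.sqrt_pos.mpr hσ
  have hlow : Tendsto (fun k : ℝ => 4 * √σ - k / (2 * √σ) * 2) (nhdsWithin 0 (Ioi 0))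
      (nhds (4 * √σ)) := by
    have : Continuous (fun k : ℝ => 4 * √σ - k / (2 * √σ) * 2) := by fun_prop
    simpa using (this.tendsto 0).mono_left nhdsWithin_le_nhds
  have hev : ∀ᶠ k : ℝ in nhdsWithin 0 (Ioi 0), k ∈ Ioo 0 (4 * σ) :=
    Ioo_mem_nhdsGT (by positivity)
  have hint : ∀ k ∈ Ioo 0 (4 * σ),
      IntervalIntegrable (fun q : ℝ => √(q * (4 * σ - q)) / q) MeasureTheory.volume 0 k := by
    intro k hk
    apply (intervalIntegrable_semicircle_div_self hσ).mono_set
    rw [uIcc_of_le hk.1.le, uIcc_of_le (hk.1.trans hk.2).le]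
    exact Icc_subset_Icc_right hk.2.le
  refine tendsto_of_tendsto_of_tendsto_of_le_of_le' hlow tendsto_const_nhds ?_ ?_
  · filter_upwards [hev] with k hkm
    have ⟨hk, hk'⟩ := hkm
    have hsk : 0 < √k := Real.sqrt_pos.mpr hk
    rw [le_div_iff₀ (by positivity)]
    have hle : ∫ q in (0 : ℝ)..k, (2 * √σ - k / (2 * √σ)) * (√q / q) ≤
        ∫ q in (0 : ℝ)..k, √(q * (4 * σ - q)) / q := by
      apply integral_mono_on hk.le
        ((intervalIntegrable_sqrt_div_self le_rfl hk.le).const_mul _) (hint k hkm)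
      intro q hq
      rw [← mul_div_assoc]
      apply div_le_div_of_nonneg_right _ hq.1
      refine le_trans ?_ (two_mul_sqrt_sub_le_sqrt_mul_sub hσ hq.1 (hq.2.trans hk'.le))
      have : q * √q / (2 * √σ) ≤ k * √q / (2 * √σ) := by
        gcongr
        exact hq.2
      have e : k / (2 * √σ) * √q = k * √q / (2 * √σ) := by ring
      rw [sub_mul, e]
      linarith
    rw [integral_const_mul, integral_sqrt_div_self le_rfl hk.le, Real.sqrt_zero] at hle
    linarith
  · filter_upwards [hev] with k hkm
    have ⟨hk, hk'⟩ := hkm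
    have hsk : 0 < √k := Real.sqrt_pos.mpr hk
    rw [div_le_iff₀ (by positivity)]
    have hle : ∫ q in (0 : ℝ)..k, √(q * (4 * σ - q)) / q ≤
        ∫ q in (0 : ℝ)..k, (2 * √σ) * (√q / q) := by
      apply integral_mono_on hk.le (hint k hkm)
        ((intervalIntegrable_sqrt_div_self le_rfl hk.le).const_mul _)
      intro q hq
      rw [← mul_div_assoc]
      exact div_le_div_of_nonneg_right (sqrt_mul_sub_le_two_mul_sqrt hσ hq.1) hq.1
    rw [integral_const_mul, integral_sqrt_div_self le_rfl hk.le, Real.sqrt_zero] at hle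
    linarith

theorem tendsto_integral_semicircle_tail {σ u : ℝ} (hσ : 0 < σ) (hu : 0 < u) :
    Tendsto (fun k : ℝ => (∫ q in k..(4 * σ),
        √(q * (4 * σ - q)) * (2 * u * k) / (q * (q + 2 * u * k))) / √k)
      (nhdsWithin 0 (Ioi 0))
      (nhds (2 * √σ * (2 * √(2 * u) * (π / 2 - arctan (1 / √(2 * u)))))) := by
  have hs : 0 < √σ := Real.sqrt_pos.mpr hσ
  have hv : 0 < √(2 * u) := Real.sqrt_pos.mpr (by positivity)
  have hv2 : √(2 * u) ^ 2 = 2 * u := Real.sq_sqrt (by positivity)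
  have hsqrt : Tendsto (fun k : ℝ => √k) (nhdsWithin 0 (Ioi 0)) (nhdsWithin 0 (Ioi 0)) := by
    apply tendsto_nhdsWithin_of_tendsto_nhds_of_eventually_within
    · simpa using (Real.continuous_sqrt.tendsto 0).mono_left nhdsWithin_le_nhds
    · filter_upwards [self_mem_nhdsWithin] with k hk
      exact Real.sqrt_pos.mpr hk
  have hinv : Tendsto (fun k : ℝ => √(4 * σ) / √(2 * u) * (√k)⁻¹)
      (nhdsWithin 0 (Ioi 0)) atTop :=
    hsqrt.inv_tendsto_nhdsGT_zero.const_mul_atTop (by positivity)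
  have hmain : Tendsto (fun k : ℝ => 2 * √σ * (2 * √(2 * u) *
      (arctan (√(4 * σ) / √(2 * u) * (√k)⁻¹) - arctan (1 / √(2 * u)))))
      (nhdsWithin 0 (Ioi 0))
      (nhds (2 * √σ * (2 * √(2 * u) * (π / 2 - arctan (1 / √(2 * u)))))) :=
    ((((Real.tendsto_arctan_atTop.mono_right nhdsWithin_le_nhds).comp hinv).sub_const _).const_mul
      _).const_mul _
  have hlow := hmain.sub ((hsqrt.mono_right nhdsWithin_le_nhds).const_mul (4 * u))
  rw [mul_zero, sub_zero] at hlow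
  have hev : ∀ᶠ k : ℝ in nhdsWithin 0 (Ioi 0), k ∈ Ioo 0 (4 * σ) :=
    Ioo_mem_nhdsGT (by positivity)
  have hrat : ∀ k ∈ Ioo 0 (4 * σ), ∀ f : ℝ → ℝ, Continuous f →
      IntervalIntegrable (fun q : ℝ => f q * (2 * u * k) / (q * (q + 2 * u * k)))
        MeasureTheory.volume k (4 * σ) := by
    intro k hk f hf
    have hk0 := hk.1
    apply ContinuousOn.intervalIntegrable
    rw [uIcc_of_le hk.2.le]
    apply ContinuousOn.div (by fun_prop) (by fun_prop)
    intro x hx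
    have := hk0.trans_le hx.1
    positivity
  have hval : ∀ k ∈ Ioo 0 (4 * σ), ∫ q in k..(4 * σ), √q * (2 * u * k) / (q * (q + 2 * u * k)) =
      2 * √(2 * u) * (arctan (√(4 * σ) / √(2 * u) * (√k)⁻¹) - arctan (1 / √(2 * u))) * √k := by
    intro k hk
    have hsk : 0 < √k := Real.sqrt_pos.mpr hk.1
    have h := integral_sqrt_mul_div_mul_add (mul_pos hv hsk) hk.1 hk.2.le
    rw [mul_pow, hv2, Real.sq_sqrt hk.1.le] at h
    rw [h]
    have e1 : √(4 * σ) / (√(2 * u) * √k) = √(4 * σ) / √(2 * u) * (√k)⁻¹ := by field_simp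
    have e2 : √k / (√(2 * u) * √k) = 1 / √(2 * u) := by field_simp
    rw [e1, e2]
    ring
  refine tendsto_of_tendsto_of_tendsto_of_le_of_le' hlow hmain ?_ ?_
  · filter_upwards [hev] with k hkm
    have ⟨hk, hk'⟩ := hkm
    have hsk : 0 < √k := Real.sqrt_pos.mpr hk
    have hkk : √k * √k = k := Real.mul_self_sqrt hk.le
    rw [le_div_iff₀ (by positivity)]
    have hle : ∫ q in k..(4 * σ), (2 * √σ * (√q * (2 * u * k) / (q * (q + 2 * u * k))) -
          u * k / √σ * (√q / q)) ≤
        ∫ q in k..(4 * σ), √(q * (4 * σ - q)) * (2 * u * k) / (q * (q + 2 * u * k)) := by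
      apply integral_mono_on hk'.le
        (((hrat k hkm _ Real.continuous_sqrt).const_mul _).sub
          ((intervalIntegrable_sqrt_div_self hk.le hk'.le).const_mul _))
        (hrat k hkm _ (by fun_prop))
      intro q hq
      have hq0 : 0 < q := hk.trans_le hq.1
      have hw : 0 ≤ 2 * u * k / (q * (q + 2 * u * k)) := by positivity
      have h1 := mul_le_mul_of_nonneg_right
        (two_mul_sqrt_sub_le_sqrt_mul_sub hσ hq0.le hq.2) hw
      have h2 : q * √q / (2 * √σ) * (2 * u * k / (q * (q + 2 * u * k))) ≤
          u * k / √σ * (√q / q) := by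
        have e : q * √q / (2 * √σ) * (2 * u * k / (q * (q + 2 * u * k))) =
            u * k / √σ * (√q / (q + 2 * u * k)) := by
          field_simp
        rw [e]
        gcongr
        linarith [show 0 < 2 * u * k by positivity]
      rw [sub_mul, ← mul_div_assoc, ← mul_div_assoc, ← mul_div_assoc] at h1
      rw [← mul_div_assoc] at h2
      have e : 2 * √σ * (√q * (2 * u * k) / (q * (q + 2 * u * k))) =
        2 * √σ * √q * (2 * u * k) / (q * (q + 2 * u * k)) := by ring
      rw [e]
      linarith
    rw [integral_sub ((hrat k hkm _ Real.continuous_sqrt).const_mul _)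
      ((intervalIntegrable_sqrt_div_self hk.le hk'.le).const_mul _), integral_const_mul,
      integral_const_mul, hval k hkm, integral_sqrt_div_self hk.le hk'.le] at hle
    have hfour : √(4 * σ) = 2 * √σ := by
      rw [Real.sqrt_mul (by norm_num), show (4 : ℝ) = 2 ^ 2 by norm_num,
        Real.sqrt_sq (by norm_num)]
    have herr : u * k / √σ * (2 * √(4 * σ) - 2 * √k) ≤ 4 * u * √k * √k := by
      calc u * k / √σ * (2 * √(4 * σ) - 2 * √k) ≤ u * k / √σ * (2 * √(4 * σ)) := by
            gcongr
            linarith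
        _ = 4 * u * √k * √k := by
            rw [hfour, mul_assoc (4 * u), hkk]
            field_simp
            ring
    linarith
  · filter_upwards [hev] with k hkm
    have ⟨hk, hk'⟩ := hkm
    have hsk : 0 < √k := Real.sqrt_pos.mpr hk
    rw [div_le_iff₀ (by positivity)]
    have hle : ∫ q in k..(4 * σ), √(q * (4 * σ - q)) * (2 * u * k) / (q * (q + 2 * u * k)) ≤
        ∫ q in k..(4 * σ), 2 * √σ * (√q * (2 * u * k) / (q * (q + 2 * u * k))) := by
      apply integral_mono_on hk'.le (hrat k hkm _ (by fun_prop))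
        ((hrat k hkm _ Real.continuous_sqrt).const_mul _)
      intro q hq
      have hq0 : 0 < q := hk.trans_le hq.1
      rw [← mul_div_assoc, ← mul_assoc (2 * √σ)]
      refine div_le_div_of_nonneg_right (mul_le_mul_of_nonneg_right ?_ ?_) ?_ <;> try positivity
      exact sqrt_mul_sub_le_two_mul_sqrt hσ hq0.le
    rw [integral_const_mul, hval k hkm] at hle
    linarith

theorem propagator_sum_sub_eq {σ u k : ℝ} (hσ : 0 < σ) (hu : 0 < u) (hk : 0 < k)
    (hk' : k < 4 * σ) :
    (1 / (2 * k * (1 + u))) * (∫ q in (0 : ℝ)..k, √(q * (4 * σ - q)) / (2 * π * σ ^ 2)) +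
        (∫ q in k..(4 * σ), (√(q * (4 * σ - q)) / (2 * π * σ ^ 2)) / (q + 2 * u * k)) - 1 / σ =
      1 / (2 * π * σ ^ 2) * (1 / (2 * (1 + u)) * ((∫ q in (0 : ℝ)..k, √(q * (4 * σ - q))) / k) -
        (∫ q in (0 : ℝ)..k, √(q * (4 * σ - q)) / q) -
        ∫ q in k..(4 * σ), √(q * (4 * σ - q)) * (2 * u * k) / (q * (q + 2 * u * k))) := by
  have hfull := intervalIntegrable_semicircle_div_self hσ
  have hleft : IntervalIntegrable (fun q : ℝ => √(q * (4 * σ - q)) / q)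
      MeasureTheory.volume 0 k := by
    apply hfull.mono_set
    rw [uIcc_of_le hk.le, uIcc_of_le (hk.trans hk').le]
    exact Icc_subset_Icc_right hk'.le
  have hright : IntervalIntegrable (fun q : ℝ => √(q * (4 * σ - q)) / q)
      MeasureTheory.volume k (4 * σ) := by
    apply hfull.mono_set
    rw [uIcc_of_le hk'.le, uIcc_of_le (hk.trans hk').le]
    exact Icc_subset_Icc_left hk.le
  have htail : IntervalIntegrable
      (fun q : ℝ => √(q * (4 * σ - q)) * (2 * u * k) / (q * (q + 2 * u * k)))
      MeasureTheory.volume k (4 * σ) := by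
    apply ContinuousOn.intervalIntegrable
    rw [uIcc_of_le hk'.le]
    apply ContinuousOn.div (by fun_prop) (by fun_prop)
    intro x hx
    have := hk.trans_le hx.1
    positivity
  have hsplit := integral_add_adjacent_intervals hleft hright
  rw [integral_semicircle_div_self hσ] at hsplit
  have hsecond : ∫ q in k..(4 * σ), (√(q * (4 * σ - q)) / (2 * π * σ ^ 2)) / (q + 2 * u * k) =
      1 / (2 * π * σ ^ 2) * ((∫ q in k..(4 * σ), √(q * (4 * σ - q)) / q) -
        ∫ q in k..(4 * σ), √(q * (4 * σ - q)) * (2 * u * k) / (q * (q + 2 * u * k))) := by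
    rw [← integral_sub hright htail, ← integral_const_mul]
    apply integral_congr
    intro q hq
    rw [uIcc_of_le hk'.le] at hq
    have hq0 : 0 < q := hk.trans_le hq.1
    have : 0 < q + 2 * u * k := by positivity
    field_simp
    ring
  have hσ' : 1 / σ = 1 / (2 * π * σ ^ 2) * (2 * π * σ) := by
    field_simp
  rw [hsecond, integral_div, hσ', ← hsplit]
  have h1u : 0 < 1 + u := by positivity
  field_simp
  ring

theorem propagator_sum_deep_IR_expansion
    (σ u : ℝ) (hσ : 0 < σ) (hu : 0 < u)
    (G : ℝ → ℝ)
    (hG : ∀ k : ℝ, 0 < k → k < 4 * σ →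
      G k = (1 / (2 * k * (1 + u))) *
              (∫ q in (0:ℝ)..k, Real.sqrt (q * (4 * σ - q)) / (2 * Real.pi * σ ^ 2)) +
            ∫ q in k..(4 * σ),
              (Real.sqrt (q * (4 * σ - q)) / (2 * Real.pi * σ ^ 2)) / (q + 2 * u * k)) :
    Filter.Tendsto (fun k : ℝ => (G k - 1 / σ) / Real.sqrt k)
      (nhdsWithin 0 (Set.Ioi 0))
      (nhds ((σ ^ ((3:ℝ)/2))⁻¹ *
        (1 / (3 * Real.pi * (1 + u)) +
          -((Real.sqrt 2 * Real.sqrt u *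
              (Real.pi - 2 * Real.arctan (1 / (Real.sqrt 2 * Real.sqrt u))) + 2) /
            Real.pi)))) := by
  have hs : 0 < √σ := Real.sqrt_pos.mpr hσ
  have hs2 : √σ ^ 2 = σ := Real.sq_sqrt hσ.le
  have h1u : 0 < 1 + u := by positivity
  have hpow : σ ^ ((3 : ℝ) / 2) = σ * √σ := by
    rw [show (3 : ℝ) / 2 = 1 + 1 / 2 by norm_num, Real.rpow_add hσ, Real.rpow_one,
      Real.sqrt_eq_rpow]
  have hlim := ((((tendsto_integral_semicircle_div hσ).const_mul (1 / (2 * (1 + u)))).sub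
    (tendsto_integral_semicircle_div_self hσ)).sub
      (tendsto_integral_semicircle_tail hσ hu)).const_mul (1 / (2 * π * σ ^ 2))
  have hval : 1 / (2 * π * σ ^ 2) * (1 / (2 * (1 + u)) * (4 / 3 * √σ) - 4 * √σ -
      2 * √σ * (2 * √(2 * u) * (π / 2 - arctan (1 / √(2 * u))))) =
      (σ ^ ((3 : ℝ) / 2))⁻¹ * (1 / (3 * π * (1 + u)) +
        -((√2 * √u * (π - 2 * arctan (1 / (√2 * √u))) + 2) / π)) := by
    rw [Real.sqrt_mul (by norm_num : (0 : ℝ) ≤ 2), hpow]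
    generalize arctan (1 / (√2 * √u)) = A
    generalize √2 * √u = B
    field_simp
    rw [hs2]
    field_simp
    ring
  rw [hval] at hlim
  refine hlim.congr' ?_
  filter_upwards [Ioo_mem_nhdsGT (show (0 : ℝ) < 4 * σ by positivity)] with k hk
  have hsk : 0 < √k := Real.sqrt_pos.mpr hk.1
  rw [hG k hk.1 hk.2, propagator_sum_sub_eq hσ hu hk.1 hk.2]
  ring
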